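/- If α ∈ ℝ satisfies α < −log(1−p)/log A or α > −log p/log A, then the level set E̲(μ,α) is empty. -/

import Mathlib

open MeasureTheory Filter Set Metric Topology

/-- `moranCyl c w n (x, ℓ)` refines the interval `[x, x + ℓ]` along the binary word `w`,
using the contraction ratio `c k` at step `k` (the first letter of `w` is processed with
index `n`).  The result `(x', ℓ')` describes the interval `[x', x' + ℓ']`. -/
noncomputable def moranCyl (c : ℕ → ℝ) : List Bool → ℕ → ℝ × ℝ → ℝ × ℝ
  | [], _, st => st
  | bb :: w, n, st =>
      moranCyl c w (n + 1)
        (if bb then (st.1 + st.2 - st.2 / c n, st.2 / c n) else (st.1, st.2 / c n))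

/-- The basic interval `I_w` of the Moran construction with ratios `c`. -/
noncomputable def moranI (c : ℕ → ℝ) (w : List Bool) : Set ℝ :=
  Icc (moranCyl c w 1 (0, 1)).1 ((moranCyl c w 1 (0, 1)).1 + (moranCyl c w 1 (0, 1)).2)

/-- The length `|I_w|` of the basic interval `I_w`. -/
noncomputable def moranLen (c : ℕ → ℝ) (w : List Bool) : ℝ :=
  (moranCyl c w 1 (0, 1)).2

/-- The Moran set `⋂ n ⋃ {I_w : |w| = n}`. -/
noncomputable def moranSet (c : ℕ → ℝ) : Set ℝ :=
  ⋂ n : ℕ, ⋃ w ∈ {w : List Bool | w.length = n}, moranI c w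

/-- The mass assigned to the cylinder `I_w` by the Moran measure with weight `r k` for the
letter at step `k`: `cylMass r w 1 1 = μ(I_w)`. -/
noncomputable def cylMass (r : ℕ → ℝ) : List Bool → ℕ → ℝ → ℝ
  | [], _, m => m
  | bb :: w, n, m => cylMass r w (n + 1) (if bb then (1 - r n) * m else r n * m)

/-- Lower local dimension `liminf_{r → 0⁺} log μ(B(x,r)) / log r`. -/
noncomputable def lowerLocalDim (μ : Measure ℝ) (x : ℝ) : ℝ :=
  liminf (fun rr : ℝ => Real.log (μ (closedBall x rr)).toReal / Real.log rr) (𝓝[>] 0)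

/-- Upper local dimension `limsup_{r → 0⁺} log μ(B(x,r)) / log r`. -/
noncomputable def upperLocalDim (μ : Measure ℝ) (x : ℝ) : ℝ :=
  limsup (fun rr : ℝ => Real.log (μ (closedBall x rr)).toReal / Real.log rr) (𝓝[>] 0)

/-- `betaFn ρ C s = -log (ρ^s + (1-ρ)^s) / log C`; so `β₁ = betaFn p A`, `β₂ = betaFn q B`. -/
noncomputable def betaFn (ρ C : ℝ) (s : ℝ) : ℝ :=
  -Real.log (ρ ^ s + (1 - ρ) ^ s) / Real.log C

/-- The Legendre transform `f^*(α) = inf_s (s α - f(s))`. -/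
noncomputable def legendre (f : ℝ → ℝ) (α : ℝ) : ℝ :=
  ⨅ s : ℝ, (s * α - f s)

/-- The modification `β̃₁` of `β₁`, linear on `(0,1)`. -/
noncomputable def betaTilde1 (ρ C : ℝ) (s : ℝ) : ℝ :=
  if s ≤ 0 ∨ 1 ≤ s then betaFn ρ C s
  else (1 - s) * betaFn ρ C 0 + s * betaFn ρ C 1

/-- `packSup μ X r s` is the supremum of `∑ᵢ μ(B(xᵢ,r))^s` over all finite families of
pairwise disjoint closed balls of radius `r` with centers in `X`. -/
noncomputable def packSup (μ : Measure ℝ) (X : Set ℝ) (rr s : ℝ) : ℝ :=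
  sSup {y : ℝ | ∃ t : Finset ℝ, (↑t : Set ℝ) ⊆ X ∧
    (↑t : Set ℝ).Pairwise (fun u v => Disjoint (closedBall u rr) (closedBall v rr)) ∧
    y = ∑ u ∈ t, (μ (closedBall u rr)).toReal ^ s}

/-- The common length of the basic intervals of level `n`. -/
noncomputable def levelLen (c : ℕ → ℝ) (n : ℕ) : ℝ :=
  ∏ k ∈ Finset.range n, (c (k + 1))⁻¹

lemma levelLen_succ (c : ℕ → ℝ) (n : ℕ) :
    levelLen c (n + 1) = levelLen c n / c (n + 1) := by
  rw [levelLen, Finset.prod_range_succ, div_eq_mul_inv, levelLen]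

lemma levelLen_pos {c : ℕ → ℝ} (hc : ∀ n, 1 ≤ n → 0 < c n) (n : ℕ) : 0 < levelLen c n :=
  Finset.prod_pos fun k _ => inv_pos.2 (hc (k + 1) (by omega))

lemma log_levelLen {c : ℕ → ℝ} (hc : ∀ n, 1 ≤ n → 0 < c n) (n : ℕ) :
    Real.log (levelLen c n) = -∑ k ∈ Finset.range n, Real.log (c (k + 1)) := by
  rw [levelLen, Real.log_prod fun k _ => (inv_pos.2 (hc (k + 1) (by omega))).ne',
    ← Finset.sum_neg_distrib]
  exact Finset.sum_congr rfl fun k _ => Real.log_inv _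

lemma tendsto_levelLen {c : ℕ → ℝ} (hc : ∀ n, 1 ≤ n → 2 < c n) :
    Tendsto (levelLen c) atTop (𝓝 0) := by
  have hpos : ∀ n, 1 ≤ n → 0 < c n := fun n hn => by linarith [hc n hn]
  have hle : ∀ n, levelLen c n ≤ (1 / 2 : ℝ) ^ n := by
    intro n
    induction n with
    | zero => simp [levelLen]
    | succ n ih =>
      have hcn := hc (n + 1) (by omega)
      rw [levelLen_succ, div_le_iff₀ (by linarith), pow_succ]
      have : (0 : ℝ) < (1 / 2) ^ n := by positivity
      nlinarith
  exact squeeze_zero (fun n => (levelLen_pos hpos n).le) hle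
    (tendsto_pow_atTop_nhds_zero_of_lt_one (by norm_num) (by norm_num))

lemma moranCyl_append_singleton (c : ℕ → ℝ) (bb : Bool) (w : List Bool) :
    ∀ (n : ℕ) (st : ℝ × ℝ), moranCyl c (w ++ [bb]) n st =
      (if bb then
        ((moranCyl c w n st).1 + (moranCyl c w n st).2 - (moranCyl c w n st).2 / c (n + w.length),
          (moranCyl c w n st).2 / c (n + w.length))
      else ((moranCyl c w n st).1, (moranCyl c w n st).2 / c (n + w.length))) := by
  induction w with
  | nil => intro n st; simp [moranCyl]
  | cons a w ih =>
    intro n st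
    simp only [List.cons_append, moranCyl, ih, List.length_cons]
    rw [show n + 1 + w.length = n + (w.length + 1) by omega]

lemma cylMass_append_singleton (r : ℕ → ℝ) (bb : Bool) (w : List Bool) :
    ∀ (n : ℕ) (m : ℝ), cylMass r (w ++ [bb]) n m =
      (if bb then 1 - r (n + w.length) else r (n + w.length)) * cylMass r w n m := by
  induction w with
  | nil => intro n m; cases bb <;> simp [cylMass]
  | cons a w ih =>
    intro n m
    simp only [List.cons_append, cylMass, ih, List.length_cons]
    rw [show n + 1 + w.length = n + (w.length + 1) by omega]

lemma moranLen_eq (c : ℕ → ℝ) (w : List Bool) : moranLen c w = levelLen c w.length := by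
  induction w using List.reverseRecOn with
  | nil => simp [moranLen, moranCyl, levelLen]
  | append_singleton w bb ih =>
    rw [List.length_append, List.length_singleton, levelLen_succ, ← ih, moranLen,
      moranCyl_append_singleton, add_comm 1 w.length]
    cases bb <;> rfl

/-- The left endpoint of the basic interval `I_w`. -/
noncomputable def moranLeft (c : ℕ → ℝ) (w : List Bool) : ℝ := (moranCyl c w 1 (0, 1)).1

lemma moranI_eq (c : ℕ → ℝ) (w : List Bool) :
    moranI c w = Icc (moranLeft c w) (moranLeft c w + levelLen c w.length) := by
  rw [← moranLen_eq]; rfl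

lemma moranI_append_false (c : ℕ → ℝ) (w : List Bool) :
    moranI c (w ++ [false]) =
      Icc (moranLeft c w) (moranLeft c w + levelLen c (w.length + 1)) := by
  rw [moranI_eq, moranLeft, moranCyl_append_singleton]
  simp [moranLeft]

lemma moranI_append_true (c : ℕ → ℝ) (w : List Bool) :
    moranI c (w ++ [true]) =
      Icc (moranLeft c w + levelLen c w.length - levelLen c (w.length + 1))
        (moranLeft c w + levelLen c w.length) := by
  have h : moranLeft c (w ++ [true]) =
      moranLeft c w + levelLen c w.length - levelLen c (w.length + 1) := by
    rw [levelLen_succ, ← moranLen_eq, moranLeft, moranCyl_append_singleton, add_comm 1 w.length]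
    simp [moranLeft, moranLen]
  rw [moranI_eq, h]
  simp

lemma two_mul_levelLen_succ_lt {c : ℕ → ℝ} (hc : ∀ n, 1 ≤ n → 2 < c n) (n : ℕ) :
    2 * levelLen c (n + 1) < levelLen c n := by
  have hcn := hc (n + 1) (by omega)
  have := levelLen_pos (c := c) (fun n hn => by linarith [hc n hn]) n
  rw [levelLen_succ, ← mul_div_assoc, div_lt_iff₀ (by linarith)]
  nlinarith

lemma moranI_append_subset {c : ℕ → ℝ} (hc : ∀ n, 1 ≤ n → 2 < c n) (w : List Bool) (bb : Bool) :
    moranI c (w ++ [bb]) ⊆ moranI c w := by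
  have hpos : ∀ n, 1 ≤ n → 0 < c n := fun n hn => by linarith [hc n hn]
  have h1 := two_mul_levelLen_succ_lt hc w.length
  have h2 := levelLen_pos hpos (w.length + 1)
  cases bb
  · rw [moranI_append_false, moranI_eq]
    exact Icc_subset_Icc le_rfl (by linarith)
  · rw [moranI_append_true, moranI_eq]
    exact Icc_subset_Icc (by linarith) le_rfl

lemma moranI_subset_closedBall {c : ℕ → ℝ} {w : List Bool} {x : ℝ} (hx : x ∈ moranI c w) :
    moranI c w ⊆ closedBall x (levelLen c w.length) := by
  intro y hy
  rw [moranI_eq] at hx hy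
  rw [mem_closedBall, Real.dist_eq]
  exact abs_sub_le_iff.2 ⟨by linarith [hx.1, hy.2], by linarith [hx.2, hy.1]⟩

lemma cylMass_pos {r : ℕ → ℝ} (hr : ∀ n, 1 ≤ n → 0 < r n ∧ r n ≤ 1 / 2) (w : List Bool) :
    0 < cylMass r w 1 1 := by
  induction w using List.reverseRecOn with
  | nil => simp [cylMass]
  | append_singleton w bb ih =>
    have := hr (1 + w.length) (by omega)
    rw [cylMass_append_singleton]
    cases bb
    · simpa using mul_pos this.1 ih
    · simpa using mul_pos (show 0 < 1 - r (1 + w.length) by linarith [this.2]) ih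

lemma sum_log_le_log_cylMass {r : ℕ → ℝ} (hr : ∀ n, 1 ≤ n → 0 < r n ∧ r n ≤ 1 / 2)
    (w : List Bool) :
    ∑ k ∈ Finset.range w.length, Real.log (r (k + 1)) ≤ Real.log (cylMass r w 1 1) := by
  induction w using List.reverseRecOn with
  | nil => simp [cylMass]
  | append_singleton w bb ih =>
    have hrn := hr (w.length + 1) (by omega)
    have hle : Real.log (r (w.length + 1)) ≤ Real.log (1 - r (w.length + 1)) :=
      Real.log_le_log hrn.1 (by linarith)
    rw [cylMass_append_singleton, add_comm 1 w.length, List.length_append, List.length_singleton,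
      Finset.sum_range_succ]
    cases bb
    · rw [if_neg (by simp), Real.log_mul hrn.1.ne' (cylMass_pos hr w).ne']
      linarith
    · rw [if_pos rfl, Real.log_mul (by linarith) (cylMass_pos hr w).ne']
      linarith

lemma log_cylMass_le {c r : ℕ → ℝ} {a : ℝ} (hc : ∀ n, 1 ≤ n → 0 < c n)
    (hr : ∀ n, 1 ≤ n → 0 < r n ∧ r n ≤ 1 / 2)
    (ha : ∀ n, 1 ≤ n → Real.log (1 - r n) ≤ -(a * Real.log (c n))) (w : List Bool) :
    Real.log (cylMass r w 1 1) ≤ a * Real.log (levelLen c w.length) := by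
  induction w using List.reverseRecOn with
  | nil => simp [cylMass, levelLen]
  | append_singleton w bb ih =>
    have hrn := hr (w.length + 1) (by omega)
    have hle : Real.log (r (w.length + 1)) ≤ Real.log (1 - r (w.length + 1)) :=
      Real.log_le_log hrn.1 (by linarith)
    have han := ha (w.length + 1) (by omega)
    rw [cylMass_append_singleton, add_comm 1 w.length, List.length_append, List.length_singleton,
      levelLen_succ, Real.log_div (levelLen_pos hc _).ne' (hc _ (by omega)).ne', mul_sub]
    cases bb
    · rw [if_neg (by simp), Real.log_mul hrn.1.ne' (cylMass_pos hr w).ne']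
      linarith
    · rw [if_pos rfl, Real.log_mul (by linarith) (cylMass_pos hr w).ne']
      linarith

lemma measure_moranI_diff_children {c r : ℕ → ℝ} (hc : ∀ n, 1 ≤ n → 2 < c n)
    (hr : ∀ n, 1 ≤ n → 0 < r n ∧ r n ≤ 1 / 2) (μ : Measure ℝ) [IsProbabilityMeasure μ]
    (hμ : ∀ w : List Bool, μ (moranI c w) = ENNReal.ofReal (cylMass r w 1 1)) (w : List Bool) :
    μ (moranI c w \ (moranI c (w ++ [false]) ∪ moranI c (w ++ [true]))) = 0 := by
  have hlt := two_mul_levelLen_succ_lt hc w.length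
  have hdisj : Disjoint (moranI c (w ++ [false])) (moranI c (w ++ [true])) := by
    rw [moranI_append_false, moranI_append_true, Set.disjoint_left]
    rintro y ⟨-, h1⟩ ⟨h2, -⟩
    linarith
  have hmeas : ∀ v, MeasurableSet (moranI c v) := fun v => measurableSet_Icc
  have hrn := hr (1 + w.length) (by omega)
  have hsum : μ (moranI c (w ++ [false]) ∪ moranI c (w ++ [true])) = μ (moranI c w) := by
    rw [measure_union hdisj (hmeas _), hμ, hμ, hμ, ← ENNReal.ofReal_add (cylMass_pos hr _).le
      (cylMass_pos hr _).le, cylMass_append_singleton, cylMass_append_singleton]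
    congr 1
    simp only [Bool.false_eq_true, if_false, if_true]
    ring
  rw [measure_sdiff (union_subset (moranI_append_subset hc w _) (moranI_append_subset hc w _))
    ((hmeas _).union (hmeas _)).nullMeasurableSet (measure_ne_top _ _), hsum, tsub_self]

lemma measure_closedBall_diff_moranI {c r : ℕ → ℝ} (hc : ∀ n, 1 ≤ n → 2 < c n)
    (hr : ∀ n, 1 ≤ n → 0 < r n ∧ r n ≤ 1 / 2) (μ : Measure ℝ) [IsProbabilityMeasure μ]
    (hμ : ∀ w : List Bool, μ (moranI c w) = ENNReal.ofReal (cylMass r w 1 1))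
    {x ρ : ℝ} (w : List Bool) (hx : x ∈ moranI c w)
    (hρ : ∀ k < w.length, ρ < levelLen c k - 2 * levelLen c (k + 1)) :
    μ (closedBall x ρ \ moranI c w) = 0 := by
  induction w using List.reverseRecOn with
  | nil =>
    have h1 : μ (moranI c []) = 1 := by simp [hμ, cylMass]
    refine measure_mono_null (fun y hy => hy.2) ?_
    exact (prob_compl_eq_zero_iff (μ := μ) measurableSet_Icc).2 h1
  | append_singleton w bb ih =>
    simp only [List.length_append, List.length_singleton] at hρ
    have hw := ih (moranI_append_subset hc w bb hx) fun k hk => hρ k (by omega)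
    have hgap := hρ w.length (by omega)
    refine measure_mono_null ?_
      (measure_union_null hw (measure_moranI_diff_children hc hr μ hμ w))
    rintro y ⟨hy, hyw⟩
    by_cases hyI : y ∈ moranI c w
    · refine Or.inr ⟨hyI, fun hu => ?_⟩
      rw [mem_closedBall, Real.dist_eq, abs_sub_le_iff] at hy
      cases bb
      · rcases hu with hu | hu
        · exact hyw hu
        · rw [moranI_append_true] at hu
          rw [moranI_append_false] at hx
          linarith [hu.1, hx.2, hy.1]
      · rcases hu with hu | hu
        · rw [moranI_append_false] at hu
          rw [moranI_append_true] at hx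
          linarith [hu.2, hx.1, hy.2]
        · exact hyw hu
    · exact Or.inl ⟨hy, hyI⟩

lemma exists_mem_moranI {c : ℕ → ℝ} {x : ℝ} (hx : x ∈ moranSet c) (n : ℕ) :
    ∃ w : List Bool, w.length = n ∧ x ∈ moranI c w := by
  simpa [moranSet] using mem_iInter.1 hx n

section LocalDimension

variable {c r : ℕ → ℝ} (μ : Measure ℝ) [IsProbabilityMeasure μ] {x : ℝ}

lemma cylMass_le_measure_closedBall (hr : ∀ n, 1 ≤ n → 0 < r n ∧ r n ≤ 1 / 2)
    (hμ : ∀ w : List Bool, μ (moranI c w) = ENNReal.ofReal (cylMass r w 1 1))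
    {w : List Bool} (hx : x ∈ moranI c w) {ρ : ℝ} (hρ : levelLen c w.length ≤ ρ) :
    cylMass r w 1 1 ≤ (μ (closedBall x ρ)).toReal := by
  rw [← ENNReal.toReal_ofReal (cylMass_pos hr w).le, ← hμ]
  exact ENNReal.toReal_mono (measure_ne_top _ _)
    (measure_mono ((moranI_subset_closedBall hx).trans (closedBall_subset_closedBall hρ)))

lemma log_measure_closedBall_le {B a : ℝ} (hB : 2 < B) (hcB : ∀ n, 1 ≤ n → B ≤ c n)
    (hr : ∀ n, 1 ≤ n → 0 < r n ∧ r n ≤ 1 / 2)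
    (hμ : ∀ w : List Bool, μ (moranI c w) = ENNReal.ofReal (cylMass r w 1 1))
    (ha0 : 0 ≤ a) (ha : ∀ n, 1 ≤ n → Real.log (1 - r n) ≤ -(a * Real.log (c n)))
    (hx : x ∈ moranSet c) {ρ : ℝ} (hρ : 0 < ρ) :
    Real.log (μ (closedBall x ρ)).toReal ≤ a * (Real.log ρ - Real.log (1 - 2 / B)) := by
  have hc : ∀ n, 1 ≤ n → 2 < c n := fun n hn => hB.trans_le (hcB n hn)
  have hpos : ∀ n, 1 ≤ n → 0 < c n := fun n hn => by linarith [hc n hn]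
  have hδ : 0 < 1 - 2 / B := by
    rw [sub_pos, div_lt_one (by linarith)]; exact hB
  obtain ⟨m, hm⟩ := ((tendsto_levelLen hc).eventually_lt_const hρ).exists
  obtain ⟨v, hvm, hxv⟩ := exists_mem_moranI hx m
  have hμpos : 0 < (μ (closedBall x ρ)).toReal :=
    (cylMass_pos hr v).trans_le (cylMass_le_measure_closedBall μ hr hμ hxv (by rw [hvm]; exact hm.le))
  have hex : ∃ n, (1 - 2 / B) * levelLen c n ≤ ρ := by
    refine ⟨m, le_trans ?_ hm.le⟩
    have h2 : 0 < 2 / B := by positivity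
    nlinarith [levelLen_pos hpos m]
  classical
  obtain ⟨n, hn, hmin⟩ : ∃ n, (1 - 2 / B) * levelLen c n ≤ ρ ∧
      ∀ k < n, ρ < (1 - 2 / B) * levelLen c k :=
    ⟨Nat.find hex, Nat.find_spec hex, fun k hk => not_le.1 (Nat.find_min hex hk)⟩
  obtain ⟨w, hwn, hxw⟩ := exists_mem_moranI hx n
  have hnull := measure_closedBall_diff_moranI hc hr μ hμ (ρ := ρ) w hxw (by
    intro k hk
    refine (hmin k (hwn ▸ hk)).trans_le ?_
    have hL := levelLen_pos hpos k
    have : levelLen c k / c (k + 1) ≤ levelLen c k / B :=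
      div_le_div_of_nonneg_left hL.le (by linarith) (hcB _ (by omega))
    rw [levelLen_succ]
    calc (1 - 2 / B) * levelLen c k = levelLen c k - 2 * (levelLen c k / B) := by ring
      _ ≤ _ := by linarith)
  have hle : (μ (closedBall x ρ)).toReal ≤ cylMass r w 1 1 := by
    rw [← ENNReal.toReal_ofReal (cylMass_pos hr w).le, ← hμ]
    exact ENNReal.toReal_mono (measure_ne_top _ _) (measure_mono_ae (ae_le_set.2 hnull))
  calc Real.log (μ (closedBall x ρ)).toReal ≤ Real.log (cylMass r w 1 1) :=
        Real.log_le_log hμpos hle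
    _ ≤ a * Real.log (levelLen c n) := hwn ▸ log_cylMass_le hpos hr ha w
    _ ≤ a * (Real.log ρ - Real.log (1 - 2 / B)) := by
        refine mul_le_mul_of_nonneg_left ?_ ha0
        have := Real.log_le_log (mul_pos hδ (levelLen_pos hpos n)) hn
        rw [Real.log_mul hδ.ne' (levelLen_pos hpos n).ne'] at this
        linarith

lemma eventually_le_log_measure_div_log {B a a' : ℝ} (hB : 2 < B) (hcB : ∀ n, 1 ≤ n → B ≤ c n)
    (hr : ∀ n, 1 ≤ n → 0 < r n ∧ r n ≤ 1 / 2)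
    (hμ : ∀ w : List Bool, μ (moranI c w) = ENNReal.ofReal (cylMass r w 1 1))
    (ha0 : 0 ≤ a) (ha : ∀ n, 1 ≤ n → Real.log (1 - r n) ≤ -(a * Real.log (c n)))
    (hx : x ∈ moranSet c) (ha' : a' < a) :
    ∀ᶠ ρ in 𝓝[>] (0 : ℝ), a' ≤ Real.log (μ (closedBall x ρ)).toReal / Real.log ρ := by
  have hlog := Real.tendsto_log_nhdsGT_zero
  filter_upwards [self_mem_nhdsWithin, hlog.eventually_lt_atBot 0,
    hlog.eventually_le_atBot (a * Real.log (1 - 2 / B) / (a - a'))] with ρ hρ h0 h1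
  have h := log_measure_closedBall_le μ hB hcB hr hμ ha0 ha hx hρ
  rw [le_div_iff₀ (by linarith)] at h1
  rw [le_div_iff_of_neg h0]
  linarith

end LocalDimension

/-- Every positive index lies in a block of one of the two types. -/
lemma block_cases {A B p q : ℝ} {N : ℕ → ℕ} {c r : ℕ → ℝ} (hN0 : N 0 = 0) (hN : StrictMono N)
    (hcA : ∀ i n : ℕ, N (2 * i) < n → n ≤ N (2 * i + 1) → c n = A)
    (hcB : ∀ i n : ℕ, N (2 * i + 1) < n → n ≤ N (2 * i + 2) → c n = B)
    (hrp : ∀ i n : ℕ, N (2 * i) < n → n ≤ N (2 * i + 1) → r n = p)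
    (hrq : ∀ i n : ℕ, N (2 * i + 1) < n → n ≤ N (2 * i + 2) → r n = q)
    (n : ℕ) (hn : 1 ≤ n) : (c n = A ∧ r n = p) ∨ (c n = B ∧ r n = q) := by
  have key : ∀ j, n ≤ N j → (c n = A ∧ r n = p) ∨ (c n = B ∧ r n = q) := by
    intro j
    induction j with
    | zero => intro h; omega
    | succ j ih =>
      intro h
      rcases le_or_gt n (N j) with h' | h'
      · exact ih h'
      · rcases Nat.even_or_odd' j with ⟨i, rfl | rfl⟩
        · exact Or.inl ⟨hcA i n h' h, hrp i n h' h⟩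
        · exact Or.inr ⟨hcB i n h' h, hrq i n h' h⟩
  exact key n hN.le_apply

lemma frequently_log_measure_div_log_le {A B p q : ℝ} {N : ℕ → ℕ} {c r : ℕ → ℝ}
    (μ : Measure ℝ) [IsProbabilityMeasure μ] {x b' : ℝ} (hN : StrictMono N)
    (hNlim : Tendsto (fun i : ℕ => (N (i + 1) : ℝ) / (N i : ℝ)) atTop atTop)
    (hA : 2 < A) (hp0 : 0 < p)
    (hblock : ∀ n, 1 ≤ n → (c n = A ∧ r n = p) ∨ (c n = B ∧ r n = q))
    (hcA : ∀ i n : ℕ, N (2 * i) < n → n ≤ N (2 * i + 1) → c n = A)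
    (hrp : ∀ i n : ℕ, N (2 * i) < n → n ≤ N (2 * i + 1) → r n = p)
    (hc : ∀ n, 1 ≤ n → 2 < c n) (hr : ∀ n, 1 ≤ n → 0 < r n ∧ r n ≤ 1 / 2)
    (hμ : ∀ w : List Bool, μ (moranI c w) = ENNReal.ofReal (cylMass r w 1 1))
    (hx : x ∈ moranSet c) (hb' : -Real.log p / Real.log A < b') :
    ∃ᶠ ρ in 𝓝[>] (0 : ℝ), Real.log (μ (closedBall x ρ)).toReal / Real.log ρ ≤ b' := by
  have hpos : ∀ n, 1 ≤ n → 0 < c n := fun n hn => by linarith [hc n hn]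
  have hlogA : 0 < Real.log A := Real.log_pos (by linarith)
  rw [div_lt_iff₀ hlogA] at hb'
  set ε := b' * Real.log A + Real.log p with hε
  have hε0 : 0 < ε := by linarith
  have hsub : Tendsto (fun i : ℕ => 2 * i) atTop atTop :=
    tendsto_id.const_mul_atTop' (by norm_num)
  have hodd : Tendsto (fun i : ℕ => N (2 * i + 1)) atTop atTop :=
    hN.tendsto_atTop.comp ((tendsto_add_atTop_nat 1).comp hsub)
  have hrad : Tendsto (fun i : ℕ => levelLen c (N (2 * i + 1))) atTop (𝓝[>] 0) :=
    tendsto_nhdsWithin_iff.2 ⟨(tendsto_levelLen hc).comp hodd,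
      Eventually.of_forall fun i => levelLen_pos hpos _⟩
  obtain ⟨C, hC⟩ : ∃ C, ∀ n, 1 ≤ n → -C ≤ Real.log (r n) := by
    refine ⟨|Real.log p| + |Real.log q|, fun n hn => ?_⟩
    rcases hblock n hn with h | h <;> rw [h.2]
    · linarith [neg_abs_le (Real.log p), abs_nonneg (Real.log q)]
    · linarith [neg_abs_le (Real.log q), abs_nonneg (Real.log p)]
  refine hrad.frequently (Eventually.frequently ?_)
  filter_upwards [(hNlim.comp hsub).eventually_ge_atTop (C / ε + 1), eventually_ge_atTop 1]
    with i hi hi1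
  simp only [Function.comp_apply] at hi
  set m := N (2 * i) with hm
  set n := N (2 * i + 1) with hn
  have hmn : m < n := hN (by omega)
  have hm0 : 0 < m := (show 0 < 2 * i by omega).trans_le hN.le_apply
  have hm0' : (0 : ℝ) < m := by exact_mod_cast hm0
  have hmn' : (0 : ℝ) < n - m := by
    rw [sub_pos]; exact_mod_cast hmn
  have hsplit : (m : ℝ) * C ≤ (n - m) * ε := by
    rw [le_div_iff₀ hm0'] at hi
    have : C / ε * m * ε ≤ (n - m) * ε := mul_le_mul_of_nonneg_right (by linarith) hε0.le
    have h2 : C / ε * m * ε = m * C := by field_simp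
    linarith
  have hcard : ((Finset.Ico m n).card : ℝ) = n - m := by
    rw [Nat.card_Ico, Nat.cast_sub hmn.le]
  have hlen : (n - m) * Real.log A ≤ -Real.log (levelLen c n) := by
    rw [log_levelLen hpos, neg_neg, ← Finset.sum_range_add_sum_Ico _ hmn.le]
    have h1 : 0 ≤ ∑ k ∈ Finset.range m, Real.log (c (k + 1)) :=
      Finset.sum_nonneg fun k _ => Real.log_nonneg (by linarith [hc (k + 1) (by omega)])
    have h2 : ∑ k ∈ Finset.Ico m n, Real.log (c (k + 1)) = (n - m) * Real.log A := by
      rw [← hcard, ← nsmul_eq_mul, ← Finset.sum_const]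
      refine Finset.sum_congr rfl fun k hk => ?_
      rw [Finset.mem_Ico] at hk
      rw [hcA i (k + 1) (by omega) (by omega)]
    linarith
  have hmass : -(m * C) + (n - m) * Real.log p ≤
      ∑ k ∈ Finset.range n, Real.log (r (k + 1)) := by
    rw [← Finset.sum_range_add_sum_Ico _ hmn.le]
    have h1 : -(m * C) ≤ ∑ k ∈ Finset.range m, Real.log (r (k + 1)) := by
      have := Finset.card_nsmul_le_sum (Finset.range m) (fun k => Real.log (r (k + 1))) (-C)
        fun k _ => hC (k + 1) (by omega)
      rw [Finset.card_range, nsmul_eq_mul] at this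
      linarith
    have h2 : ∑ k ∈ Finset.Ico m n, Real.log (r (k + 1)) = (n - m) * Real.log p := by
      rw [← hcard, ← nsmul_eq_mul, ← Finset.sum_const]
      refine Finset.sum_congr rfl fun k hk => ?_
      rw [Finset.mem_Ico] at hk
      rw [hrp i (k + 1) (by omega) (by omega)]
    linarith
  obtain ⟨w, hwn, hxw⟩ := exists_mem_moranI hx n
  have hball : Real.log (cylMass r w 1 1) ≤
      Real.log (μ (closedBall x (levelLen c n))).toReal :=
    Real.log_le_log (cylMass_pos hr w) (cylMass_le_measure_closedBall μ hr hμ hxw (by rw [hwn]))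
  have hw := sum_log_le_log_cylMass hr w
  rw [hwn] at hw
  have hb0 : 0 ≤ b' := by
    have hp2 : p ≤ 1 := by
      have := hr n (by omega)
      rw [hrp i n hmn le_rfl] at this
      linarith [this.2]
    have := Real.log_nonpos hp0.le hp2
    by_contra! hneg
    nlinarith
  have hLneg : Real.log (levelLen c n) < 0 := by nlinarith
  rw [div_le_iff_of_neg hLneg]
  have h3 := mul_le_mul_of_nonneg_left hlen hb0
  have h4 : (n - m : ℝ) * ε = b' * ((n - m) * Real.log A) + (n - m) * Real.log p := by
    rw [hε]; ring
  linarith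

/-- if α < −log(1−p)/log A or α > −log p/log A, then the level set
E̲(μ,α) = {x ∈ X : d̲(μ,x) = α} is empty. -/
theorem stmt_6 (A B p q : ℝ) (N : ℕ → ℕ)
    (hBA : B < A) (hB2 : 2 < B)
    (hp0 : 0 < p) (hp2 : p ≤ 1 / 2) (hq0 : 0 < q) (hq2 : q ≤ 1 / 2)
    (hN0 : N 0 = 0) (hNmono : StrictMono N)
    (hNlim : Tendsto (fun i : ℕ => (N (i + 1) : ℝ) / (N i : ℝ)) atTop atTop)
    (hpq : -Real.log p / Real.log A < -Real.log (1 - q) / Real.log B)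
    (c r : ℕ → ℝ)
    (hcA : ∀ i n : ℕ, N (2 * i) < n → n ≤ N (2 * i + 1) → c n = A)
    (hcB : ∀ i n : ℕ, N (2 * i + 1) < n → n ≤ N (2 * i + 2) → c n = B)
    (hrp : ∀ i n : ℕ, N (2 * i) < n → n ≤ N (2 * i + 1) → r n = p)
    (hrq : ∀ i n : ℕ, N (2 * i + 1) < n → n ≤ N (2 * i + 2) → r n = q)
    (μ : Measure ℝ) [IsProbabilityMeasure μ]
    (hμ : ∀ w : List Bool, μ (moranI c w) = ENNReal.ofReal (cylMass r w 1 1))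
    (α : ℝ)
    (hα : α < -Real.log (1 - p) / Real.log A ∨ -Real.log p / Real.log A < α) :
    {x | x ∈ moranSet c ∧ lowerLocalDim μ x = α} = (∅ : Set ℝ) := by
  have hA2 : 2 < A := hB2.trans hBA
  have hlogB : 0 < Real.log B := Real.log_pos (by linarith)
  have hlogA : 0 < Real.log A := Real.log_pos (by linarith)
  have hlogp : Real.log p < 0 := Real.log_neg hp0 (by linarith)
  have hlogq : Real.log q < 0 := Real.log_neg hq0 (by linarith)
  have hblock := block_cases hN0 hNmono hcA hcB hrp hrq
  have hcB' : ∀ n, 1 ≤ n → B ≤ c n := by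
    intro n hn
    rcases hblock n hn with h | h
    · rw [h.1]; exact hBA.le
    · exact h.1.ge
  have hc : ∀ n, 1 ≤ n → 2 < c n := fun n hn => hB2.trans_le (hcB' n hn)
  have hpos : ∀ n, 1 ≤ n → 0 < c n := fun n hn => by linarith [hc n hn]
  have hr : ∀ n, 1 ≤ n → 0 < r n ∧ r n ≤ 1 / 2 := by
    intro n hn
    rcases hblock n hn with h | h <;> rw [h.2]
    exacts [⟨hp0, hp2⟩, ⟨hq0, hq2⟩]
  have hlog1p : Real.log p ≤ Real.log (1 - p) := Real.log_le_log hp0 (by linarith)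
  have ha0 : 0 ≤ -Real.log (1 - p) / Real.log A :=
    div_nonneg (neg_nonneg.2 (Real.log_nonpos (by linarith) (by linarith))) hlogA.le
  have hab : -Real.log (1 - p) / Real.log A ≤ -Real.log p / Real.log A := by gcongr
  have ha : ∀ n, 1 ≤ n →
      Real.log (1 - r n) ≤ -(-Real.log (1 - p) / Real.log A * Real.log (c n)) := by
    intro n hn
    rcases hblock n hn with h | h <;> rw [h.1, h.2]
    · rw [div_mul_cancel₀ _ hlogA.ne', neg_neg]
    · have := (lt_div_iff₀ hlogB).1 (hab.trans_lt hpq)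
      linarith
  rw [Set.eq_empty_iff_forall_notMem]
  rintro x ⟨hx, hdim⟩
  have hlower := fun a' => eventually_le_log_measure_div_log (a' := a') μ hB2 hcB' hr hμ ha0 ha hx
  have hupper := fun b' => frequently_log_measure_div_log_le (b' := b') μ hNmono hNlim hA2 hp0
    hblock hcA hrp hc hr hμ hx
  have hbdd : IsBoundedUnder (· ≥ ·) (𝓝[>] (0 : ℝ))
      (fun ρ => Real.log (μ (closedBall x ρ)).toReal / Real.log ρ) :=
    isBoundedUnder_of_eventually_ge (hlower _ (sub_one_lt _))
  rcases hα with h | h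
  · obtain ⟨a', h1, h2⟩ := exists_between h
    have : a' ≤ lowerLocalDim μ x :=
      le_liminf_of_le (IsCoboundedUnder.of_frequently_le (hupper _ (lt_add_one _))) (hlower a' h2)
    linarith
  · obtain ⟨b', h1, h2⟩ := exists_between h
    have : lowerLocalDim μ x ≤ b' := liminf_le_of_frequently_le (hupper b' h1) hbdd
    linarith
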